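/- Let (Z,ρ) be a semimetric space of negative type and let k be any measurable kernel on Z that generates ρ, i.e., ρ(z,z') = k(z,z)+k(z',z')−2k(z,z'). Then for all Borel probability measures P, Q on Z with finite first moment with respect to ρ, D_{E,ρ}(P,Q) = 2γ_k²(P,Q); explicitly, 2∫∫ρ(z,w)dP(z)dQ(w) − ∫∫ρ(z,z')dP(z)dP(z') − ∫∫ρ(w,w')dQ(w)dQ(w') = 2[∫∫k(z,z')dP(z)dP(z') + ∫∫k(w,w')dQ(w)dQ(w') − 2∫∫k(z,w)dP(z)dQ(w)]. In particular, equivalent kernels have the same maximum mean discrepancy. -/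

import Mathlib

open MeasureTheory

/-- A semimetric on a nonempty set `Z`: nonnegative, vanishing exactly on the
diagonal, and symmetric. -/
def IsSemimetric {Z : Type*} (ρ : Z → Z → ℝ) : Prop :=
  (∀ z z', 0 ≤ ρ z z') ∧ (∀ z z', ρ z z' = 0 ↔ z = z') ∧ (∀ z z', ρ z z' = ρ z' z)

/-- A function `ρ` has negative type if for all `n ≥ 2`, points `z_1,…,z_n` and
reals `α_1,…,α_n` with `Σ α_i = 0`, one has `Σ_i Σ_j α_i α_j ρ(z_i,z_j) ≤ 0`. -/
def HasNegativeType {Z : Type*} (ρ : Z → Z → ℝ) : Prop :=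
  ∀ (n : ℕ), 2 ≤ n → ∀ (z : Fin n → Z) (α : Fin n → ℝ),
    (∑ i, α i) = 0 → ∑ i, ∑ j, α i * α j * ρ (z i) (z j) ≤ 0

/-- A kernel on `Z`: a symmetric positive definite function `k : Z × Z → ℝ`. -/
def IsPosDefKernel {Z : Type*} (k : Z → Z → ℝ) : Prop :=
  (∀ z z', k z z' = k z' z) ∧
  ∀ (n : ℕ) (z : Fin n → Z) (α : Fin n → ℝ),
    0 ≤ ∑ i, ∑ j, α i * α j * k (z i) (z j)

lemma IsPosDefKernel.quadratic_nonneg {Z : Type*} {k : Z → Z → ℝ} (hk : IsPosDefKernel k)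
    (z w : Z) (a b : ℝ) : 0 ≤ a ^ 2 * k z z + 2 * a * b * k z w + b ^ 2 * k w w := by
  have h := hk.2 2 ![z, w] ![a, b]
  simp only [Fin.sum_univ_two, Matrix.cons_val_zero, Matrix.cons_val_one] at h
  rw [hk.1 w z] at h
  linarith

lemma IsPosDefKernel.self_nonneg {Z : Type*} {k : Z → Z → ℝ} (hk : IsPosDefKernel k) (z : Z) :
    0 ≤ k z z := by
  simpa using hk.quadratic_nonneg z z 1 0

lemma IsPosDefKernel.abs_le {Z : Type*} {k : Z → Z → ℝ} (hk : IsPosDefKernel k) (z w : Z) :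
    |k z w| ≤ k z z + k w w := by
  have h₁ := hk.quadratic_nonneg z w 1 1
  have h₂ := hk.quadratic_nonneg z w 1 (-1)
  have hz := hk.self_nonneg z
  have hw := hk.self_nonneg w
  rw [_root_.abs_le]
  constructor <;> linarith

lemma measurable_kernel_diag {Z : Type*} [MeasurableSpace Z] {k : Z → Z → ℝ}
    (hmeas : Measurable fun p : Z × Z => k p.1 p.2) : Measurable fun z => k z z :=
  hmeas.comp (measurable_id.prodMk measurable_id)

/-- A finite first moment with respect to the generated semimetric makes the diagonal of the
kernel integrable. -/
lemma IsPosDefKernel.integrable_diag {Z : Type*} [MeasurableSpace Z] {ρ k : Z → Z → ℝ}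
    (hk : IsPosDefKernel k) (hmeas : Measurable fun p : Z × Z => k p.1 p.2)
    (hgen : ∀ z z', ρ z z' = k z z + k z' z' - 2 * k z z')
    {μ : Measure Z} [IsFiniteMeasure μ] (hμ : ∃ z₀ : Z, Integrable (fun z => ρ z z₀) μ) :
    Integrable (fun z => k z z) μ := by
  obtain ⟨z₀, h⟩ := hμ
  refine ((h.const_mul 2).add (integrable_const (2 * k z₀ z₀))).mono'
    (measurable_kernel_diag hmeas).aestronglyMeasurable (ae_of_all _ fun z => ?_)
  rw [Real.norm_of_nonneg (hk.self_nonneg z)]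
  have h₁ := hk.quadratic_nonneg z z₀ 1 (-2)
  simp only [Pi.add_apply, hgen]
  linarith

lemma IsPosDefKernel.integral_integral_generated {Z : Type*} [MeasurableSpace Z] {ρ k : Z → Z → ℝ}
    (hk : IsPosDefKernel k) (hmeas : Measurable fun p : Z × Z => k p.1 p.2)
    (hgen : ∀ z z', ρ z z' = k z z + k z' z' - 2 * k z z')
    {μ ν : Measure Z} [IsProbabilityMeasure μ] [IsProbabilityMeasure ν]
    (hμ : Integrable (fun z => k z z) μ) (hν : Integrable (fun z => k z z) ν) :
    ∫ z, (∫ w, ρ z w ∂ν) ∂μ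
      = (∫ z, k z z ∂μ) + (∫ w, k w w ∂ν) - 2 * ∫ z, (∫ w, k z w ∂ν) ∂μ := by
  have hprod : Integrable (fun p : Z × Z => k p.1 p.2) (μ.prod ν) :=
    ((hμ.comp_fst ν).add (hν.comp_snd μ)).mono' hmeas.aestronglyMeasurable
      (ae_of_all _ fun p => hk.abs_le p.1 p.2)
  have hsection (z : Z) : Integrable (fun w => k z w) ν :=
    ((integrable_const (k z z)).add hν).mono'
      (hmeas.comp measurable_prodMk_left).aestronglyMeasurable (ae_of_all _ fun w => hk.abs_le z w)
  have hinner (z : Z) : ∫ w, ρ z w ∂ν = k z z + (∫ w, k w w ∂ν) - 2 * ∫ w, k z w ∂ν := by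
    simp_rw [hgen]
    rw [integral_sub (f := fun w => k z z + k w w) ((integrable_const _).add hν)
        ((hsection z).const_mul 2),
      integral_add (integrable_const _) hν, integral_const_mul]
    simp
  simp_rw [hinner]
  rw [integral_sub (f := fun z => k z z + ∫ w, k w w ∂ν) (g := fun z => 2 * ∫ w, k z w ∂ν)
      (hμ.add (integrable_const _)) (hprod.integral_prod_left.const_mul 2),
    integral_add hμ (integrable_const _), integral_const_mul]
  simp

/-- for any measurable kernel `k` generating a semimetric `ρ` of
negative type, and any Borel probability measures `P`, `Q` with finite first
moments w.r.t. `ρ`, the energy distance equals twice the squared MMD: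
`D_{E,ρ}(P,Q) = 2 γ_k²(P,Q)`. -/
theorem energy_distance_eq_two_mmd_sq
    {Z : Type*} [Nonempty Z] [TopologicalSpace Z] [MeasurableSpace Z] [BorelSpace Z]
    (ρ : Z → Z → ℝ) (hsemi : IsSemimetric ρ) (hneg : HasNegativeType ρ)
    (k : Z → Z → ℝ) (hker : IsPosDefKernel k)
    (hmeas : Measurable fun p : Z × Z => k p.1 p.2)
    (hgen : ∀ z z', ρ z z' = k z z + k z' z' - 2 * k z z')
    (P Q : Measure Z) [IsProbabilityMeasure P] [IsProbabilityMeasure Q]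
    (hP : ∃ z₀ : Z, Integrable (fun z => ρ z z₀) P)
    (hQ : ∃ z₀ : Z, Integrable (fun w => ρ w z₀) Q) :
    2 * (∫ z, (∫ w, ρ z w ∂Q) ∂P) - (∫ z, (∫ z', ρ z z' ∂P) ∂P)
        - (∫ w, (∫ w', ρ w w' ∂Q) ∂Q) =
      2 * ((∫ z, (∫ z', k z z' ∂P) ∂P) + (∫ w, (∫ w', k w w' ∂Q) ∂Q)
        - 2 * (∫ z, (∫ w, k z w ∂Q) ∂P)) := by
  have hdP := hker.integrable_diag hmeas hgen hP
  have hdQ := hker.integrable_diag hmeas hgen hQ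
  rw [hker.integral_integral_generated hmeas hgen hdP hdQ,
    hker.integral_integral_generated hmeas hgen hdP hdP,
    hker.integral_integral_generated hmeas hgen hdQ hdQ]
  ring
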